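/- Let ρ = |ψ⟩⟨ψ| and ρ̃ = |φ⟩⟨φ| be pure two-qubit density matrices (rank-one projections onto unit vectors ψ, φ ∈ ℂ⁴). Then ‖r̃^{(1)}‖² = ‖r^{(1)}‖², ‖r̃^{(2)}‖² = ‖r^{(2)}‖², and ‖T̃‖² = ‖T‖² hold simultaneously if and only if there exist U₁, U₂ ∈ SU(2) with ρ̃ = (U₁ ⊗ U₂) ρ (U₁ ⊗ U₂)†. -/

import Mathlib

open Matrix Complex BigOperators Kronecker
open scoped ComplexOrder

/-- The three Pauli matrices σ₁, σ₂, σ₃ (indexed by `Fin 3`). -/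
noncomputable def pauli : Fin 3 → Matrix (Fin 2) (Fin 2) ℂ
  | 0 => !![0, 1; 1, 0]
  | 1 => !![0, -Complex.I; Complex.I, 0]
  | 2 => !![1, 0; 0, -1]

/-- Marginal Bloch vector of the first qubit: `r⁽¹⁾_i = Tr (ρ (σ_i ⊗ 1))`. -/
noncomputable def bloch1 (ρ : Matrix (Fin 2 × Fin 2) (Fin 2 × Fin 2) ℂ) : Fin 3 → ℝ :=
  fun i => ((ρ * (pauli i ⊗ₖ (1 : Matrix (Fin 2) (Fin 2) ℂ))).trace).re

/-- Marginal Bloch vector of the second qubit: `r⁽²⁾_j = Tr (ρ (1 ⊗ σ_j))`. -/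
noncomputable def bloch2 (ρ : Matrix (Fin 2 × Fin 2) (Fin 2 × Fin 2) ℂ) : Fin 3 → ℝ :=
  fun j => ((ρ * ((1 : Matrix (Fin 2) (Fin 2) ℂ) ⊗ₖ pauli j)).trace).re

/-- Correlation matrix: `T_{ij} = Tr (ρ (σ_i ⊗ σ_j))`. -/
noncomputable def corr (ρ : Matrix (Fin 2 × Fin 2) (Fin 2 × Fin 2) ℂ) :
    Matrix (Fin 3) (Fin 3) ℝ :=
  Matrix.of fun i j => ((ρ * (pauli i ⊗ₖ pauli j)).trace).re

/-- Membership in SU(2): unitary 2×2 complex matrix of determinant 1. -/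
def IsSU2 (U : Matrix (Fin 2) (Fin 2) ℂ) : Prop := Uᴴ * U = 1 ∧ U.det = 1

/-- Membership in SO(3): orthogonal 3×3 real matrix of determinant 1. -/
def IsSO3 (Q : Matrix (Fin 3) (Fin 3) ℝ) : Prop := Qᵀ * Q = 1 ∧ Q.det = 1

/-- The rank one matrix of a vector. -/
noncomputable def rk1 (v : Fin 2 × Fin 2 → ℂ) : Matrix (Fin 2 × Fin 2) (Fin 2 × Fin 2) ℂ :=
  Matrix.of fun p q => v p * (starRingEnd ℂ) (v q)

/-- The squared modulus of the determinant of the coefficient matrix. -/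
noncomputable def dsq (v : Fin 2 × Fin 2 → ℂ) : ℝ :=
  Complex.normSq (v (0,0) * v (1,1) - v (0,1) * v (1,0))

lemma moments1 (v : Fin 2 × Fin 2 → ℂ) :
    (∑ i, (bloch1 (rk1 v) i) ^ 2) = (∑ x, Complex.normSq (v x)) ^ 2 - 4 * dsq v := by
  simp [Fin.sum_univ_three, bloch1, rk1, dsq, pauli, Matrix.trace, Matrix.mul_apply,
    Fintype.sum_prod_type, Fin.sum_univ_two, Matrix.kroneckerMap_apply, Complex.normSq_apply,
    Matrix.one_apply]
  ring

lemma moments2 (v : Fin 2 × Fin 2 → ℂ) :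
    (∑ i, (bloch2 (rk1 v) i) ^ 2) = (∑ x, Complex.normSq (v x)) ^ 2 - 4 * dsq v := by
  simp [Fin.sum_univ_three, bloch2, rk1, dsq, pauli, Matrix.trace, Matrix.mul_apply,
    Fintype.sum_prod_type, Fin.sum_univ_two, Matrix.kroneckerMap_apply, Complex.normSq_apply,
    Matrix.one_apply]
  ring

lemma moments3 (v : Fin 2 × Fin 2 → ℂ) :
    (∑ i, ∑ j, (corr (rk1 v) i j) ^ 2) = (∑ x, Complex.normSq (v x)) ^ 2 + 8 * dsq v := by
  simp [Fin.sum_univ_three, corr, rk1, dsq, pauli, Matrix.trace, Matrix.mul_apply,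
    Fintype.sum_prod_type, Fin.sum_univ_two, Matrix.kroneckerMap_apply, Complex.normSq_apply]
  ring

lemma rk1_trace (v : Fin 2 × Fin 2 → ℂ) :
    (rk1 v).trace = ((∑ x, Complex.normSq (v x) : ℝ) : ℂ) := by
  simp [rk1, Matrix.trace, Complex.mul_conj]

lemma rk1_conj (M : Matrix (Fin 2 × Fin 2) (Fin 2 × Fin 2) ℂ) (v : Fin 2 × Fin 2 → ℂ) :
    M * rk1 v * Mᴴ = rk1 (M *ᵥ v) := by
  have h (w : Fin 2 × Fin 2 → ℂ) : rk1 w = vecMulVec w (star w) := by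
    ext p q; simp [rk1, vecMulVec_apply]
  rw [h, h, mul_vecMulVec, vecMulVec_mul, star_mulVec]

/-- Coefficient matrix. -/
def coeffM (v : Fin 2 × Fin 2 → ℂ) : Matrix (Fin 2) (Fin 2) ℂ := Matrix.of fun i j => v (i, j)

lemma coeffM_kron (U V : Matrix (Fin 2) (Fin 2) ℂ) (v : Fin 2 × Fin 2 → ℂ) :
    coeffM ((U ⊗ₖ V) *ᵥ v) = U * coeffM v * Vᵀ := by
  ext i j
  simp [coeffM, Matrix.mulVec, dotProduct, Fintype.sum_prod_type, Fin.sum_univ_two,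
    Matrix.mul_apply, Matrix.kroneckerMap_apply]
  ring

lemma dsq_eq (v : Fin 2 × Fin 2 → ℂ) : dsq v = Complex.normSq (coeffM v).det := by
  simp [dsq, coeffM, Matrix.det_fin_two]

lemma coeffM_tr (v : Fin 2 × Fin 2 → ℂ) :
    (coeffM v * (coeffM v)ᴴ).trace = ((∑ x, Complex.normSq (v x) : ℝ) : ℂ) := by
  simp [coeffM, Matrix.trace, Matrix.mul_apply, Complex.mul_conj, Fintype.sum_prod_type,
    Fin.sum_univ_two]

lemma exists_phase (z : ℂ) : ∃ e : ℂ, e * star e = 1 ∧ z = (‖z‖ : ℂ) * e := by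
  refine ⟨Complex.exp (z.arg * Complex.I), ?_, (Complex.norm_mul_exp_arg_mul_I z).symm⟩
  have := Complex.mul_conj' (Complex.exp (z.arg * Complex.I))
  rw [Complex.norm_exp_ofReal_mul_I] at this
  simpa using this

lemma to_su2 (U : Matrix (Fin 2) (Fin 2) ℂ) (hU : U ∈ unitaryGroup (Fin 2) ℂ) :
    ∃ (c : ℂ) (U' : Matrix (Fin 2) (Fin 2) ℂ), c * star c = 1 ∧ IsSU2 U' ∧ U = c • U' := by
  have hd : star U.det * U.det = 1 := by
    have := congrArg Matrix.det (mem_unitaryGroup_iff'.1 hU)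
    rwa [det_mul, star_eq_conjTranspose, det_conjTranspose, det_one] at this
  obtain ⟨c, hc⟩ := IsAlgClosed.exists_pow_nat_eq U.det (n := 2) (by norm_num)
  have hn : ‖c‖ = 1 := by
    have h1 : ‖U.det‖ * ‖U.det‖ = 1 := by
      have := congrArg norm hd
      simpa using this
    rw [← hc, norm_pow] at h1
    have h2 : ‖c‖ ^ 4 = 1 := by rw [← h1]; ring
    exact (pow_eq_one_iff_of_nonneg (norm_nonneg _) (by norm_num)).1 h2
  have hcc : c * star c = 1 := by
    have := Complex.mul_conj' c
    rw [hn] at this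
    simpa using this
  refine ⟨c, star c • U, hcc, ⟨?_, ?_⟩, ?_⟩
  · rw [conjTranspose_smul, smul_mul_smul_comm, star_star, hcc, one_smul]
    exact mem_unitaryGroup_iff'.1 hU
  · rw [det_smul, ← hc]
    simp only [Fintype.card_fin]
    rw [← mul_pow, mul_comm, hcc, one_pow]
  · rw [smul_smul, hcc, one_smul]

lemma diag_step (A : Matrix (Fin 2) (Fin 2) ℂ) :
    ∃ W ∈ unitaryGroup (Fin 2) ℂ, ∃ l0 l1 : ℝ, l1 ≤ l0 ∧
      (W * A) * (W * A)ᴴ = !![(l0 : ℂ), 0; 0, (l1 : ℂ)] := by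
  have hH : (A * Aᴴ).IsHermitian := isHermitian_mul_conjTranspose_self A
  set U := hH.eigenvectorUnitary with hUdef
  have hU := U.2
  have hs := hH.spectral_theorem
  have key : (star (U : Matrix (Fin 2) (Fin 2) ℂ) * A) * (star (U : Matrix (Fin 2) (Fin 2) ℂ) * A)ᴴ
      = !![(hH.eigenvalues 0 : ℂ), 0; 0, (hH.eigenvalues 1 : ℂ)] := by
    have e : !![(hH.eigenvalues 0 : ℂ), 0; 0, (hH.eigenvalues 1 : ℂ)]
        = diagonal (RCLike.ofReal ∘ hH.eigenvalues) := by
      ext i j; fin_cases i <;> fin_cases j <;> simp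
    rw [e, ← hH.conjStarAlgAut_star_eigenvectorUnitary, Unitary.conjStarAlgAut_apply]
    simp [conjTranspose_mul, Matrix.mul_assoc, star_eq_conjTranspose, hUdef]
  by_cases h : hH.eigenvalues 1 ≤ hH.eigenvalues 0
  · exact ⟨_, Unitary.star_mem hU, _, _, h, key⟩
  · have hS : !![(0:ℂ), 1; 1, 0] ∈ unitaryGroup (Fin 2) ℂ := by
      rw [mem_unitaryGroup_iff]
      ext i j; fin_cases i <;> fin_cases j <;> simp [Matrix.mul_apply, star_eq_conjTranspose]
    refine ⟨_, mul_mem hS (Unitary.star_mem hU), hH.eigenvalues 1, hH.eigenvalues 0,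
      (not_le.1 h).le, ?_⟩
    rw [Matrix.mul_assoc (!![(0:ℂ), 1; 1, 0]), conjTranspose_mul (!![(0:ℂ), 1; 1, 0]),
      Matrix.mul_assoc (!![(0:ℂ), 1; 1, 0]),
      ← Matrix.mul_assoc (star (U : Matrix (Fin 2) (Fin 2) ℂ) * A), key]
    ext i j; fin_cases i <;> fin_cases j <;> simp [Matrix.vecMul, dotProduct]

lemma row_step (M : Matrix (Fin 2) (Fin 2) ℂ) (l0 l1 : ℝ) (hl : l1 ≤ l0) (hp : 0 < l0)
    (hM : M * Mᴴ = !![(l0 : ℂ), 0; 0, (l1 : ℂ)]) :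
    ∃ V ∈ unitaryGroup (Fin 2) ℂ, ∃ s t : ℝ, 0 ≤ t ∧ t ≤ s ∧
      M * V = !![(s : ℂ), 0; 0, (t : ℂ)] := by
  have hs0 : 0 < Real.sqrt l0 := Real.sqrt_pos.2 hp
  set s := Real.sqrt l0 with hs
  have hss : s * s = l0 := Real.mul_self_sqrt hp.le
  have hsc : (s : ℂ) ≠ 0 := by exact_mod_cast hs0.ne'
  have hssc : (s : ℂ) * s = l0 := by exact_mod_cast hss
  have h00 := congrFun (congrFun hM 0) 0
  have h10 := congrFun (congrFun hM 1) 0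
  have h11 := congrFun (congrFun hM 1) 1
  simp [Matrix.mul_apply, Fin.sum_univ_two] at h00 h10 h11
  set a := M 0 0
  set b := M 0 1
  set c := M 1 0
  set d := M 1 1
  obtain ⟨e, he, hz⟩ := exists_phase ((a * d - b * c) / s)
  set t := ‖(a * d - b * c) / s‖ with ht
  let V : Matrix (Fin 2) (Fin 2) ℂ :=
    !![star a / s, -b * star e / s; star b / s, a * star e / s]
  have hV : V ∈ unitaryGroup (Fin 2) ℂ := by
    rw [mem_unitaryGroup_iff']
    simp at he
    ext i j; fin_cases i <;> fin_cases j <;>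
      simp [V, Matrix.mul_apply, star_eq_conjTranspose, Fin.sum_univ_two] <;> field_simp
    · linear_combination h00 - hssc
    · ring
    · ring
    · linear_combination (h00) * e * (starRingEnd ℂ) e - hssc + l0 * he
  have hMV : M * V = !![(s : ℂ), 0; 0, (t : ℂ)] := by
    simp at he
    have hz' : (a * d - b * c) = s * (t * e) := by rw [← hz]; field_simp
    ext i j; fin_cases i <;> fin_cases j <;>
      simp [V, Matrix.mul_apply, Fin.sum_univ_two]
    · change a * (_ / _) + b * (_ / _) = _
      field_simp
      linear_combination h00 - hssc
    · change a * (_ / _) + b * (_ / _) = _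
      field_simp
      ring
    · change c * (_ / _) + d * (_ / _) = _
      field_simp
      linear_combination h10
    · change c * (_ / _) + d * (_ / _) = _
      field_simp
      linear_combination hz' * (starRingEnd ℂ) e + s * t * he
  refine ⟨V, hV, s, t, norm_nonneg _, ?_, hMV⟩
  have h2 : (M * V) * (M * V)ᴴ = M * Mᴴ := by
    rw [conjTranspose_mul, Matrix.mul_assoc, ← Matrix.mul_assoc V, ← star_eq_conjTranspose V,
      mem_unitaryGroup_iff.1 hV, Matrix.one_mul]
  rw [hM, hMV] at h2
  have h3 := congrFun (congrFun h2 1) 1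
  simp [Matrix.mul_apply, Fin.sum_univ_two] at h3
  have h4 : t * t = l1 := by exact_mod_cast h3
  exact abs_le_of_sq_le_sq' (by nlinarith) hs0.le |>.2

lemma svd2 (A : Matrix (Fin 2) (Fin 2) ℂ) (hA : (A * Aᴴ).trace = 1) :
    ∃ W ∈ unitaryGroup (Fin 2) ℂ, ∃ V ∈ unitaryGroup (Fin 2) ℂ, ∃ s t : ℝ,
      0 ≤ t ∧ t ≤ s ∧ s ^ 2 + t ^ 2 = 1 ∧ s ^ 2 * t ^ 2 = Complex.normSq A.det ∧
      W * A * V = !![(s : ℂ), 0; 0, (t : ℂ)] := by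
  obtain ⟨W, hW, l0, l1, hl, hWA⟩ := diag_step A
  have htr : ((W * A) * (W * A)ᴴ).trace = 1 := by
    rw [conjTranspose_mul, Matrix.mul_assoc, trace_mul_comm, Matrix.mul_assoc, Matrix.mul_assoc,
      ← star_eq_conjTranspose W, mem_unitaryGroup_iff'.1 hW, Matrix.mul_one, hA]
  have hsum : l0 + l1 = 1 := by
    rw [hWA] at htr
    simp [Matrix.trace, Fin.sum_univ_two] at htr
    exact_mod_cast htr
  obtain ⟨V, hV, s, t, h0, h1, hMV⟩ := row_step (W * A) l0 l1 hl (by linarith) hWA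
  refine ⟨W, hW, V, hV, s, t, h0, h1, ?_, ?_, hMV⟩
  · have h2 : (W * A * V) * (W * A * V)ᴴ = (W * A) * (W * A)ᴴ := by
      rw [conjTranspose_mul (W * A) V, Matrix.mul_assoc (W * A), ← Matrix.mul_assoc V,
        ← star_eq_conjTranspose V, mem_unitaryGroup_iff.1 hV, Matrix.one_mul]
    rw [← h2, hMV] at htr
    simp [Matrix.trace, Fin.sum_univ_two, Matrix.vecMul, dotProduct] at htr
    have : s * s + t * t = 1 := by exact_mod_cast htr
    linarith
  · have hd (X : Matrix (Fin 2) (Fin 2) ℂ) (hX : X ∈ unitaryGroup (Fin 2) ℂ) :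
        Complex.normSq X.det = 1 := by
      have := congrArg Matrix.det (mem_unitaryGroup_iff.1 hX)
      rw [det_mul, star_eq_conjTranspose, det_conjTranspose, det_one] at this
      have h5 := Complex.mul_conj X.det
      rw [starRingEnd_apply, this] at h5
      exact_mod_cast h5.symm
    have h3 := congrArg (fun X => Complex.normSq X.det) hMV
    simp only [det_mul, map_mul, hd W hW, hd V hV, one_mul, mul_one] at h3
    rw [h3]
    simp [Matrix.det_fin_two]
    ring

lemma forward (ψ φ : Fin 2 × Fin 2 → ℂ)
    (hψ : ∑ x, Complex.normSq (ψ x) = 1)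
    (hφ : ∑ x, Complex.normSq (φ x) = 1) (h : dsq φ = dsq ψ) :
    ∃ U₁ U₂ : Matrix (Fin 2) (Fin 2) ℂ, IsSU2 U₁ ∧ IsSU2 U₂ ∧
      rk1 φ = rk1 ((U₁ ⊗ₖ U₂) *ᵥ ψ) := by
  obtain ⟨W, hW, V, hV, s, t, ht, hst, hn, hd, hA⟩ := svd2 (coeffM ψ) (by
    rw [coeffM_tr, hψ]; simp)
  obtain ⟨W', hW', V', hV', s', t', ht', hst', hn', hd', hB⟩ := svd2 (coeffM φ) (by
    rw [coeffM_tr, hφ]; simp)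
  rw [← dsq_eq] at hd hd'
  have hdd : s ^ 2 * t ^ 2 = s' ^ 2 * t' ^ 2 := by rw [hd, hd', h]
  have hdiff : s ^ 2 - t ^ 2 = s' ^ 2 - t' ^ 2 := by
    rw [← sq_eq_sq₀ (by nlinarith) (by nlinarith)]
    have e1 : (s ^ 2 - t ^ 2) ^ 2 = (s ^ 2 + t ^ 2) ^ 2 - 4 * (s ^ 2 * t ^ 2) := by ring
    have e2 : (s' ^ 2 - t' ^ 2) ^ 2 = (s' ^ 2 + t' ^ 2) ^ 2 - 4 * (s' ^ 2 * t' ^ 2) := by ring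
    rw [e1, e2, hn, hn', hdd]
  have hs : s = s' := by
    rw [← sq_eq_sq₀ (by linarith) (by linarith)]; linarith
  have htt : t = t' := by
    rw [← sq_eq_sq₀ ht ht']; linarith
  subst hs htt
  have hB2 : coeffM φ = (star W' * W) * coeffM ψ * (V * star V') := by
    have e : W' * coeffM φ * V' = W * coeffM ψ * V := by rw [hA, hB]
    calc coeffM φ = (star W' * W') * coeffM φ * (V' * star V') := by
          rw [mem_unitaryGroup_iff'.1 hW', mem_unitaryGroup_iff.1 hV', Matrix.one_mul,
            Matrix.mul_one]
      _ = star W' * (W' * coeffM φ * V') * star V' := by simp only [Matrix.mul_assoc]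
      _ = _ := by rw [e]; simp only [Matrix.mul_assoc]
  obtain ⟨c, U₁, hc, hU₁, e1⟩ := to_su2 _ (mul_mem (Unitary.star_mem hW') hW)
  obtain ⟨c', U₂, hc', hU₂, e2⟩ := to_su2 _ (mul_mem hV (Unitary.star_mem hV'))
  refine ⟨U₁, U₂ᵀ, hU₁, ⟨?_, by rw [det_transpose]; exact hU₂.2⟩, ?_⟩
  · have := congrArg Matrix.transpose (mul_eq_one_comm.1 hU₂.1)
    rw [transpose_mul, transpose_one] at this
    rw [← this]
    rfl
  · have e3 : coeffM φ = (c * c') • coeffM ((U₁ ⊗ₖ U₂ᵀ) *ᵥ ψ) := by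
      rw [coeffM_kron, hB2, e1, e2, transpose_transpose]
      simp [smul_smul, mul_comm]
    have e4 (p : Fin 2 × Fin 2) : φ p = (c * c') * ((U₁ ⊗ₖ U₂ᵀ) *ᵥ ψ) p :=
      congrFun (congrFun e3 p.1) p.2
    ext p q
    simp only [rk1, of_apply, e4, map_mul]
    rw [← starRingEnd_apply] at hc hc'
    generalize ((U₁ ⊗ₖ U₂ᵀ) *ᵥ ψ) p = x
    generalize (starRingEnd ℂ) (((U₁ ⊗ₖ U₂ᵀ) *ᵥ ψ) q) = y
    linear_combination x * y * (c * (starRingEnd ℂ) c * hc' + hc)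

/-- For pure two-qubit states ρ = |ψ⟩⟨ψ| and ρ̃ = |φ⟩⟨φ| (ψ, φ unit
vectors of ℂ⁴ ≅ ℂ²⊗ℂ²), equality of all global and marginal second-order moments is
equivalent to local-unitary equivalence via some `U₁ ⊗ U₂` with `U₁, U₂ ∈ SU(2)`. -/
theorem pure_states_equal_moments_iff_LU
    (ψ φ : Fin 2 × Fin 2 → ℂ)
    (hψ : ∑ x, Complex.normSq (ψ x) = 1)
    (hφ : ∑ x, Complex.normSq (φ x) = 1)
    (ρ ρt : Matrix (Fin 2 × Fin 2) (Fin 2 × Fin 2) ℂ)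
    (hρ : ρ = Matrix.of fun p q => ψ p * (starRingEnd ℂ) (ψ q))
    (hρt : ρt = Matrix.of fun p q => φ p * (starRingEnd ℂ) (φ q)) :
    ((∑ i, (bloch1 ρt i) ^ 2) = (∑ i, (bloch1 ρ i) ^ 2) ∧
     (∑ j, (bloch2 ρt j) ^ 2) = (∑ j, (bloch2 ρ j) ^ 2) ∧
     (∑ i, ∑ j, (corr ρt i j) ^ 2) = (∑ i, ∑ j, (corr ρ i j) ^ 2)) ↔
    (∃ U₁ U₂ : Matrix (Fin 2) (Fin 2) ℂ, IsSU2 U₁ ∧ IsSU2 U₂ ∧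
      ρt = (U₁ ⊗ₖ U₂) * ρ * (U₁ ⊗ₖ U₂)ᴴ) := by
  have e1 : ρ = rk1 ψ := hρ
  have e2 : ρt = rk1 φ := hρt
  rw [e1, e2]
  simp only [rk1_conj]
  constructor
  · rintro ⟨h, -, -⟩
    rw [moments1, moments1, hψ, hφ] at h
    exact forward ψ φ hψ hφ (by linarith)
  · rintro ⟨U₁, U₂, h1, h2, h⟩
    have hn : ∑ x, Complex.normSq (((U₁ ⊗ₖ U₂) *ᵥ ψ) x) = 1 := by
      have h3 := congrArg Matrix.trace h
      rw [rk1_trace, rk1_trace, hφ] at h3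
      exact_mod_cast h3.symm
    have hd : dsq ((U₁ ⊗ₖ U₂) *ᵥ ψ) = dsq ψ := by
      rw [dsq_eq, dsq_eq, coeffM_kron, det_mul, det_mul, det_transpose, h1.2, h2.2]
      simp
    rw [h]
    simp only [moments1, moments2, moments3, hn, hψ, hd, and_self]
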